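/- (Sub-Gaussianity of linear functionals of the Hadamard Response estimate.) Let K be a power of 2 and H_K the K×K ±1 Hadamard matrix. Let t = (t_1,...,t_K) ∈ [0,1]^K, and let t̂_1,...,t̂_K be independent random variables where each t̂_j is the average of m_j ≥ n/(2K) i.i.d. Bernoulli(t_j) random variables. Set V = ((e^ε+1)/(K(e^ε−1)))·H_K·(2(t̂ − t)). Then for every ξ ∈ ℝ^K with ‖ξ‖₂ ≤ 1, the random variable ⟨V, ξ⟩ is zero-mean sub-Gaussian with variance proxy at most (2/n)·((e^ε+1)/(e^ε−1))². -/

import Mathlib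

open Real BigOperators Finset
open scoped Classical

noncomputable section

/-- Entry `(x,y)` of the `K × K` Sylvester Hadamard matrix (`K = 2^m`). -/
def had (K : ℕ) (x y : Fin K) : ℝ := (-1 : ℝ) ^ ((Nat.digits 2 (x.val &&& y.val)).sum)

/-- pmf of the array of independent Bernoulli bits: coordinate `(j,a)` equals `true`
with probability `t j`. -/
def bernP {m : ℕ} (mj : Fin (2 ^ m) → ℕ) (t : Fin (2 ^ m) → ℝ)
    (ω : (j : Fin (2 ^ m)) → Fin (mj j) → Bool) : ℝ :=
  ∏ j, ∏ a, if ω j a then t j else 1 - t j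

/-- `t̂_j`: the empirical mean of the `m_j` Bernoulli(`t_j`) bits in group `j`. -/
def tHat {m : ℕ} (mj : Fin (2 ^ m) → ℕ)
    (ω : (j : Fin (2 ^ m)) → Fin (mj j) → Bool) (j : Fin (2 ^ m)) : ℝ :=
  ((Finset.univ.filter fun a => ω j a = true).card : ℝ) / (mj j : ℝ)

/-- `⟨V, ξ⟩` where `V = ((e^ε+1)/(K(e^ε−1)))·H_K·(2(t̂ − t))`. -/
def Vinner {m : ℕ} (ε : ℝ) (mj : Fin (2 ^ m) → ℕ) (t : Fin (2 ^ m) → ℝ)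
    (ω : (j : Fin (2 ^ m)) → Fin (mj j) → Bool) (ξ : Fin (2 ^ m) → ℝ) : ℝ :=
  ∑ x, (((Real.exp ε + 1) / (((2 : ℝ) ^ m) * (Real.exp ε - 1))) *
    ∑ j, had (2 ^ m) x j * (2 * (tHat mj ω j - t j))) * ξ x

section Hadamard

/-- The `(x, y)` entry of the infinite Sylvester Hadamard matrix. -/
def sylvester (x y : ℕ) : ℝ := (-1 : ℝ) ^ (Nat.digits 2 (x &&& y)).sum

lemma digits_two_sum_eq (n : ℕ) :
    (Nat.digits 2 n).sum = n % 2 + (Nat.digits 2 (n / 2)).sum := by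
  rcases Nat.eq_zero_or_pos n with rfl | h
  · simp
  · rw [Nat.digits_def' (by norm_num) h, List.sum_cons]

lemma sylvester_eq (x y : ℕ) :
    sylvester x y = (-1 : ℝ) ^ ((x % 2) * (y % 2)) * sylvester (x / 2) (y / 2) := by
  have hmod : (x &&& y) % 2 = (x % 2) * (y % 2) := by
    have h : (x &&& y) % 2 = (x % 2) &&& (y % 2) := Nat.and_mod_two_pow (n := 1)
    rw [h]
    rcases Nat.mod_two_eq_zero_or_one x with h | h <;>
      rcases Nat.mod_two_eq_zero_or_one y with h' | h' <;> simp [h, h']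
  have hdiv : (x &&& y) / 2 = (x / 2) &&& (y / 2) := Nat.and_div_two
  rw [sylvester, digits_two_sum_eq, hmod, hdiv, pow_add, sylvester]

lemma sum_range_two_mul_eq (f : ℕ → ℝ) (N : ℕ) :
    ∑ y ∈ range (2 * N), f y = ∑ y ∈ range N, (f (2 * y) + f (2 * y + 1)) := by
  induction N with
  | zero => simp
  | succ N ih =>
    rw [sum_range_succ, ← ih, mul_add, mul_one, sum_range_succ, sum_range_succ]
    ring

lemma sum_sylvester_mul_sylvester (m : ℕ) : ∀ x x' : ℕ, x < 2 ^ m → x' < 2 ^ m →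
    ∑ y ∈ range (2 ^ m), sylvester x y * sylvester x' y = if x = x' then (2 : ℝ) ^ m else 0 := by
  induction m with
  | zero =>
    intro x x' hx hx'
    obtain rfl : x = 0 := by simpa using hx
    obtain rfl : x' = 0 := by simpa using hx'
    simp [sylvester]
  | succ m ih =>
    intro x x' hx hx'
    have hrec := ih (x / 2) (x' / 2) (by omega) (by omega)
    have hterm : ∀ y, sylvester x (2 * y) * sylvester x' (2 * y) +
        sylvester x (2 * y + 1) * sylvester x' (2 * y + 1) =
        (1 + (-1 : ℝ) ^ (x % 2 + x' % 2)) * (sylvester (x / 2) y * sylvester (x' / 2) y) := by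
      intro y
      rw [sylvester_eq x, sylvester_eq x', sylvester_eq x (2 * y + 1), sylvester_eq x' (2 * y + 1)]
      have h1 : (2 * y + 1) / 2 = y := by omega
      have h2 : (2 * y + 1) % 2 = 1 := by omega
      have h3 : (2 * y) / 2 = y := by omega
      have h4 : (2 * y) % 2 = 0 := by omega
      rw [h1, h2, h3, h4, pow_add]
      simp only [mul_zero, pow_zero, mul_one, one_mul]
      ring
    rw [pow_succ', sum_range_two_mul_eq, sum_congr rfl fun y _ => hterm y, ← mul_sum, hrec]
    rcases Nat.mod_two_eq_zero_or_one x with h | h <;>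
      rcases Nat.mod_two_eq_zero_or_one x' with h' | h' <;>
      simp only [h, h'] <;> by_cases hxx : x / 2 = x' / 2
    all_goals first
      | have hne : x ≠ x' := by omega
        simp [hne, hxx]
      | have heq : x = x' := by omega
        simp [heq, pow_succ]
        try ring

lemma sum_had_mul_had (m : ℕ) (x x' : Fin (2 ^ m)) :
    ∑ j, had (2 ^ m) x j * had (2 ^ m) x' j = if x = x' then (2 : ℝ) ^ m else 0 := by
  have h := sum_sylvester_mul_sylvester m x x' x.isLt x'.isLt
  rw [← Fin.sum_univ_eq_sum_range (fun y => sylvester x y * sylvester x' y)] at h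
  simpa only [Fin.ext_iff, had, sylvester] using h

/-- Parseval's identity for the Hadamard matrix. -/
lemma sum_sq_had_transform (m : ℕ) (ξ : Fin (2 ^ m) → ℝ) :
    ∑ j, (∑ x, had (2 ^ m) x j * ξ x) ^ 2 = (2 : ℝ) ^ m * ∑ x, ξ x ^ 2 := by
  calc ∑ j, (∑ x, had (2 ^ m) x j * ξ x) ^ 2
      = ∑ j, ∑ x, ∑ x', ξ x * ξ x' * (had (2 ^ m) x j * had (2 ^ m) x' j) := by
        refine sum_congr rfl fun j _ => ?_
        rw [sq, sum_mul_sum]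
        exact sum_congr rfl fun x _ => sum_congr rfl fun x' _ => by ring
    _ = ∑ x, ∑ x', ξ x * ξ x' * ∑ j, had (2 ^ m) x j * had (2 ^ m) x' j := by
        rw [sum_comm]
        refine sum_congr rfl fun x _ => ?_
        rw [sum_comm]
        exact sum_congr rfl fun x' _ => (mul_sum _ _ _).symm
    _ = (2 : ℝ) ^ m * ∑ x, ξ x ^ 2 := by
        simp only [sum_had_mul_had, mul_ite, mul_zero, sum_ite_eq, mem_univ, if_true, mul_sum]
        exact sum_congr rfl fun x _ => by ring

end Hadamard

section Bernoulli

open MeasureTheory ProbabilityTheory in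
/-- Hoeffding's lemma for a centred Bernoulli variable. -/
lemma bernoulli_mgf_le {t : ℝ} (h0 : 0 ≤ t) (h1 : t ≤ 1) (s : ℝ) :
    t * exp (s * (1 - t)) + (1 - t) * exp (s * (0 - t)) ≤ exp (s ^ 2 / 8) := by
  let μ : Measure ℝ := ENNReal.ofReal t • Measure.dirac 1 + ENNReal.ofReal (1 - t) • Measure.dirac 0
  have hint : ∀ f : ℝ → ℝ, ∫ x, f x ∂μ = t * f 1 + (1 - t) * f 0 := by
    intro f
    have hd : ∀ (c a : ℝ), Integrable f (ENNReal.ofReal c • Measure.dirac a) := fun c a =>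
      (integrable_dirac (by simp)).smul_measure ENNReal.ofReal_ne_top
    rw [integral_add_measure (hd _ _) (hd _ _), integral_smul_measure, integral_smul_measure,
      integral_dirac, integral_dirac, ENNReal.toReal_ofReal h0,
      ENNReal.toReal_ofReal (sub_nonneg.2 h1), smul_eq_mul, smul_eq_mul]
  have hμ : IsProbabilityMeasure μ := ⟨by
    simp only [μ, Measure.add_apply, Measure.smul_apply, measure_univ, smul_eq_mul, mul_one]
    rw [← ENNReal.ofReal_add h0 (sub_nonneg.2 h1)]
    simp⟩
  have hmem : ∀ᵐ x ∂μ, id x ∈ Set.Icc (0 : ℝ) 1 := by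
    rw [ae_add_measure_iff]
    constructor <;> refine Measure.ae_smul_measure ?_ _ <;> rw [ae_dirac_eq] <;> simp
  have h := (hasSubgaussianMGF_of_mem_Icc aemeasurable_id hmem).mgf_le s
  rw [mgf, hint, hint] at h
  norm_num at h ⊢
  refine h.trans (exp_le_exp.2 (le_of_eq ?_))
  ring

variable {ι : Type*} [Fintype ι] [DecidableEq ι]

lemma sum_pi_prod_mul_sum_eq_zero (p g : ι → Bool → ℝ)
    (hg : ∀ i, ∑ b, p i b * g i b = 0) :
    ∑ ω : ι → Bool, (∏ i, p i (ω i)) * ∑ i, g i (ω i) = 0 := by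
  simp only [mul_sum]
  rw [sum_comm]
  refine sum_eq_zero fun i₀ _ => ?_
  have hterm : ∀ ω : ι → Bool, (∏ i, p i (ω i)) * g i₀ (ω i₀) =
      ∏ i, (p i (ω i) * if i = i₀ then g i (ω i) else 1) := by
    intro ω
    rw [prod_mul_distrib, prod_ite_eq' univ i₀ fun i => g i (ω i), if_pos (mem_univ _)]
  rw [sum_congr rfl fun ω _ => hterm ω,
    ← Fintype.prod_sum fun i b => p i b * if i = i₀ then g i b else 1]
  exact prod_eq_zero (mem_univ i₀) (by simpa using hg i₀)

lemma sum_pi_prod_mul_exp_sum (p g : ι → Bool → ℝ) :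
    ∑ ω : ι → Bool, (∏ i, p i (ω i)) * exp (∑ i, g i (ω i)) =
      ∏ i, ∑ b, p i b * exp (g i b) := by
  rw [Fintype.prod_sum fun i b => p i b * exp (g i b)]
  exact sum_congr rfl fun ω _ => by rw [exp_sum, prod_mul_distrib]

end Bernoulli

section Estimate

variable {m : ℕ}

lemma bernP_eq_prod_sigma (mj : Fin (2 ^ m) → ℕ) (t : Fin (2 ^ m) → ℝ)
    (ω : (j : Fin (2 ^ m)) → Fin (mj j) → Bool) :
    bernP mj t ω = ∏ i : (j : Fin (2 ^ m)) × Fin (mj j), if ω i.1 i.2 then t i.1 else 1 - t i.1 := by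
  rw [Fintype.prod_sigma]
  rfl

/-- The coefficient of `t̂_j - t_j` in `⟨V, ξ⟩`. -/
def hadCoeff (ε : ℝ) (ξ : Fin (2 ^ m) → ℝ) (j : Fin (2 ^ m)) : ℝ :=
  2 * ((exp ε + 1) / ((2 : ℝ) ^ m * (exp ε - 1))) * ∑ x, had (2 ^ m) x j * ξ x

lemma tHat_sub_eq_sum (mj : Fin (2 ^ m) → ℕ) (t : Fin (2 ^ m) → ℝ)
    (ω : (j : Fin (2 ^ m)) → Fin (mj j) → Bool) (j : Fin (2 ^ m)) (hj : 0 < mj j) :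
    tHat mj ω j - t j = ∑ a, ((if ω j a then 1 else 0) - t j) / (mj j : ℝ) := by
  have hne : (mj j : ℝ) ≠ 0 := by positivity
  rw [← sum_div, sum_sub_distrib, sum_boole, tHat]
  simp
  field_simp

lemma Vinner_eq_sum_sigma (ε : ℝ) (mj : Fin (2 ^ m) → ℕ) (hmj : ∀ j, 0 < mj j)
    (t : Fin (2 ^ m) → ℝ) (ω : (j : Fin (2 ^ m)) → Fin (mj j) → Bool) (ξ : Fin (2 ^ m) → ℝ) :
    Vinner ε mj t ω ξ = ∑ i : (j : Fin (2 ^ m)) × Fin (mj j),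
      hadCoeff ε ξ i.1 / mj i.1 * ((if ω i.1 i.2 then 1 else 0) - t i.1) := by
  rw [Fintype.sum_sigma, Vinner]
  simp only [mul_sum, sum_mul]
  rw [sum_comm]
  refine sum_congr rfl fun j _ => ?_
  have h : ∑ a, hadCoeff ε ξ j / mj j * ((if ω j a then 1 else 0) - t j) =
      hadCoeff ε ξ j * (tHat mj ω j - t j) := by
    rw [tHat_sub_eq_sum mj t ω j (hmj j), mul_sum]
    exact sum_congr rfl fun a _ => by ring
  rw [h, hadCoeff, mul_sum, sum_mul]
  exact sum_congr rfl fun x _ => by ring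

lemma sum_sq_hadCoeff (ε : ℝ) (ξ : Fin (2 ^ m) → ℝ) :
    ∑ j, hadCoeff ε ξ j ^ 2 =
      4 / (2 : ℝ) ^ m * ((exp ε + 1) / (exp ε - 1)) ^ 2 * ∑ x, ξ x ^ 2 := by
  simp only [hadCoeff, mul_pow _ (∑ x, _)]
  rw [← mul_sum, sum_sq_had_transform, div_mul_eq_div_div_swap]
  field_simp
  ring

lemma sum_curry {mj : Fin (2 ^ m) → ℕ} (F : ((j : Fin (2 ^ m)) → Fin (mj j) → Bool) → ℝ) :
    ∑ ω, F ω = ∑ ω : ((j : Fin (2 ^ m)) × Fin (mj j)) → Bool, F (Sigma.curry ω) :=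
  ((Equiv.piCurry fun (j : Fin (2 ^ m)) (_ : Fin (mj j)) => Bool).sum_comp F).symm

end Estimate

/-- Sub-Gaussianity of linear functionals of the Hadamard Response estimate: if each `t̂_j`
is an average of `m_j ≥ n/(2K)` i.i.d. Bernoulli(`t_j`) bits (independent across `j`), and
`V = ((e^ε+1)/(K(e^ε−1)))·H_K·(2(t̂ − t))`, then for every `ξ` with `‖ξ‖₂ ≤ 1` the random
variable `⟨V, ξ⟩` has mean zero and mgf `E[exp(λ⟨V,ξ⟩)] ≤ exp(λ²σ²/2)` with variance proxy
`σ² = (2/n)((e^ε+1)/(e^ε−1))²`. -/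
theorem subgaussian_hadamard_linear (m n : ℕ) (hn : 0 < n) (ε : ℝ) (hε : 0 < ε)
    (t : Fin (2 ^ m) → ℝ) (ht : ∀ j, 0 ≤ t j ∧ t j ≤ 1)
    (mj : Fin (2 ^ m) → ℕ) (hmj : ∀ j, 0 < mj j)
    (hmjn : ∀ j, (n : ℝ) / (2 * (2 : ℝ) ^ m) ≤ (mj j : ℝ)) :
    ∀ ξ : Fin (2 ^ m) → ℝ, ∑ x, ξ x ^ 2 ≤ 1 →
      (∑ ω : (j : Fin (2 ^ m)) → Fin (mj j) → Bool,
          bernP mj t ω * Vinner ε mj t ω ξ = 0) ∧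
      ∀ lam : ℝ,
        ∑ ω : (j : Fin (2 ^ m)) → Fin (mj j) → Bool,
            bernP mj t ω * Real.exp (lam * Vinner ε mj t ω ξ) ≤
          Real.exp (lam ^ 2 * ((2 / (n : ℝ)) * ((Real.exp ε + 1) / (Real.exp ε - 1)) ^ 2) / 2) := by
  intro ξ hξ
  let p : (j : Fin (2 ^ m)) × Fin (mj j) → Bool → ℝ := fun i b => if b then t i.1 else 1 - t i.1
  let g : (j : Fin (2 ^ m)) × Fin (mj j) → Bool → ℝ := fun i b =>
    hadCoeff ε ξ i.1 / mj i.1 * ((if b then 1 else 0) - t i.1)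
  have hP : ∀ ω, bernP mj t (Sigma.curry ω) = ∏ i, p i (ω i) := fun ω =>
    bernP_eq_prod_sigma mj t _
  have hV : ∀ ω, Vinner ε mj t (Sigma.curry ω) ξ = ∑ i, g i (ω i) := fun ω =>
    Vinner_eq_sum_sigma ε mj hmj t _ ξ
  refine ⟨?_, fun lam => ?_⟩
  · rw [sum_curry]
    simp only [hP, hV]
    exact sum_pi_prod_mul_sum_eq_zero p g fun i => by
      simp only [p, g, Fintype.sum_bool, if_true, Bool.false_eq_true, if_false]
      ring
  · rw [sum_curry]
    simp only [hP, hV, mul_sum]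
    rw [sum_pi_prod_mul_exp_sum p fun i b => lam * g i b]
    have hfactor : ∀ i, ∑ b, p i b * exp (lam * g i b) ≤
        exp ((lam * (hadCoeff ε ξ i.1 / mj i.1)) ^ 2 / 8) := by
      intro i
      simpa [p, g, mul_assoc] using
        bernoulli_mgf_le (ht i.1).1 (ht i.1).2 (lam * (hadCoeff ε ξ i.1 / mj i.1))
    refine (prod_le_prod (fun i _ => ?_) fun i _ => hfactor i).trans ?_
    · refine sum_nonneg fun b _ => mul_nonneg ?_ (exp_pos _).le
      have := ht i.1
      simp only [p]
      split_ifs <;> linarith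
    rw [← exp_sum, exp_le_exp, Fintype.sum_sigma]
    have hnR : (0 : ℝ) < n := by exact_mod_cast hn
    have hK : (0 : ℝ) < 2 ^ m := by positivity
    have hgroup : ∀ j, ∑ _a : Fin (mj j), (lam * (hadCoeff ε ξ j / mj j)) ^ 2 / 8 ≤
        lam ^ 2 * (2 ^ m / (4 * n)) * hadCoeff ε ξ j ^ 2 := by
      intro j
      have hj : (0 : ℝ) < mj j := by exact_mod_cast hmj j
      have hinv : 1 / (mj j : ℝ) ≤ 2 * 2 ^ m / n := by
        have := hmjn j
        rw [div_le_iff₀ (by positivity)] at this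
        rw [div_le_div_iff₀ hj hnR]
        linarith
      calc ∑ _a : Fin (mj j), (lam * (hadCoeff ε ξ j / mj j)) ^ 2 / 8
          = lam ^ 2 * hadCoeff ε ξ j ^ 2 / 8 * (1 / mj j) := by
            rw [sum_const, card_univ, Fintype.card_fin, nsmul_eq_mul]
            field_simp
        _ ≤ lam ^ 2 * hadCoeff ε ξ j ^ 2 / 8 * (2 * 2 ^ m / n) := by gcongr
        _ = lam ^ 2 * (2 ^ m / (4 * n)) * hadCoeff ε ξ j ^ 2 := by ring
    refine (sum_le_sum fun j _ => hgroup j).trans ?_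
    rw [← mul_sum, sum_sq_hadCoeff]
    calc lam ^ 2 * (2 ^ m / (4 * n)) *
          (4 / 2 ^ m * ((exp ε + 1) / (exp ε - 1)) ^ 2 * ∑ x, ξ x ^ 2)
        = lam ^ 2 * (1 / n * ((exp ε + 1) / (exp ε - 1)) ^ 2) * ∑ x, ξ x ^ 2 := by
          field_simp
      _ ≤ lam ^ 2 * (1 / n * ((exp ε + 1) / (exp ε - 1)) ^ 2) * 1 := by gcongr
      _ = lam ^ 2 * (2 / n * ((exp ε + 1) / (exp ε - 1)) ^ 2) / 2 := by ring
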